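/- arXiv:cs/0607094 — 9 statements merged into one kernel-verified Lean document; each statement's English description precedes it below -/
import Mathlib

section
/- Let 𝓕 be a family of finite subsets of a set U satisfying axioms L1 and L2, and let K, L ∈ 𝓕 with K ⊂ L and |L \ K| = n. Then there exists a chain of sets K = K₀ ⊂ K₁ ⊂ ⋯ ⊂ Kₙ = L, all belonging to 𝓕, such that for each i ∈ {1,…,n} there is an element qᵢ with Kᵢ = Kᵢ₋₁ ∪ {qᵢ}. -/
/-- Axiom L1 of a learning space: any nonempty state can be reached by
learning one concept at a time. -/
def AxiomL1 {U : Type*} [DecidableEq U] (F : Set (Finset U)) : Prop :=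
  ∀ S ∈ F, S.Nonempty → ∃ x ∈ S, S.erase x ∈ F

/-- Axiom L2 of a learning space: learning one concept cannot interfere with
the ability to learn a different concept. -/
def AxiomL2 {U : Type*} [DecidableEq U] (F : Set (Finset U)) : Prop :=
  ∀ (S : Finset U) (x y : U), S ∈ F → insert x S ∈ F → insert y S ∈ F →
    insert x (insert y S) ∈ F

/-- A family satisfying L1 and L2 is closed under unions. -/
theorem AxiomL2.union_mem {U : Type*} [DecidableEq U] {F : Set (Finset U)}
    (hL2 : AxiomL2 F) (hL1 : AxiomL1 F) (A B : Finset U) (hA : A ∈ F) (hB : B ∈ F) :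
    A ∪ B ∈ F := by
  rcases A.eq_empty_or_nonempty with rfl | hAne
  · simpa using hB
  rcases B.eq_empty_or_nonempty with rfl | hBne
  · simpa using hA
  obtain ⟨x, hx, hAx⟩ := hL1 A hA hAne
  obtain ⟨y, hy, hBy⟩ := hL1 B hB hBne
  have hxcard := Finset.card_erase_lt_of_mem hx
  have hycard := Finset.card_erase_lt_of_mem hy
  have hleft : insert x (A.erase x ∪ B.erase y) = A ∪ B.erase y := by
    rw [← Finset.insert_union, Finset.insert_erase hx]
  have hright : insert y (A.erase x ∪ B.erase y) = A.erase x ∪ B := by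
    rw [← Finset.union_insert, Finset.insert_erase hy]
  have hunion := hL2 (A.erase x ∪ B.erase y) x y
    (hL2.union_mem hL1 _ _ hAx hBy)
    (hleft ▸ hL2.union_mem hL1 _ _ hA hBy)
    (hright ▸ hL2.union_mem hL1 _ _ hAx hB)
  rwa [hright, ← Finset.insert_union, Finset.insert_erase hx] at hunion
termination_by A.card + B.card

/-- A member of the family can be enlarged inside the family by a single element
of any other member not contained in it. -/
theorem AxiomL2.exists_insert_mem {U : Type*} [DecidableEq U] {F : Set (Finset U)}
    (hL2 : AxiomL2 F) (hL1 : AxiomL1 F) {K : Finset U} (hK : K ∈ F)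
    (L : Finset U) (hL : L ∈ F) (hLK : ¬ L ⊆ K) :
    ∃ q ∈ L, q ∉ K ∧ insert q K ∈ F := by
  have hne : L.Nonempty := by
    rw [Finset.nonempty_iff_ne_empty]
    rintro rfl
    exact hLK (Finset.empty_subset K)
  obtain ⟨x, hx, hLx⟩ := hL1 L hL hne
  by_cases hsub : L.erase x ⊆ K
  · have hunion : L ∪ K = insert x K := by
      rw [← Finset.insert_erase hx, Finset.insert_union, Finset.union_eq_right.mpr hsub]
    refine ⟨x, hx, fun hxK => hLK ?_, hunion ▸ hL2.union_mem hL1 L K hL hK⟩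
    rw [← Finset.insert_erase hx]
    exact Finset.insert_subset hxK hsub
  · have hcard := Finset.card_erase_lt_of_mem hx
    obtain ⟨q, hq, hqK, hmem⟩ := hL2.exists_insert_mem hL1 hK (L.erase x) hLx hsub
    exact ⟨q, Finset.mem_of_mem_erase hq, hqK, hmem⟩
termination_by L.card

/-- Nested members of the family are joined by a chain in the family whose steps
each add one element. -/
theorem AxiomL2.exists_chain {U : Type*} [DecidableEq U] {F : Set (Finset U)}
    (hL2 : AxiomL2 F) (hL1 : AxiomL1 F) {L : Finset U} (hL : L ∈ F) (n : ℕ)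
    (K : Finset U) (hK : K ∈ F) (hKL : K ⊆ L) (hn : (L \ K).card = n) :
    ∃ C : ℕ → Finset U, C 0 = K ∧ C n = L ∧ (∀ i ≤ n, C i ∈ F) ∧
      (∀ i < n, ∃ q, q ∉ C i ∧ C (i + 1) = insert q (C i)) := by
  induction n generalizing K with
  | zero =>
    have hLK : L ⊆ K := by simpa using hn
    exact ⟨fun _ => K, rfl, hKL.antisymm hLK, fun _ _ => hK, by simp⟩
  | succ n ih =>
    have hLK : ¬ L ⊆ K := fun h => by simp [Finset.sdiff_eq_empty_iff_subset.mpr h] at hn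
    obtain ⟨q, hqL, hqK, hmem⟩ := hL2.exists_insert_mem hL1 hK L hL hLK
    have hcard : (L \ insert q K).card = n := by
      rw [Finset.sdiff_insert, Finset.card_erase_of_mem (Finset.mem_sdiff.mpr ⟨hqL, hqK⟩), hn,
        Nat.add_sub_cancel]
    obtain ⟨C, hC0, hCn, hCF, hCstep⟩ := ih _ hmem (Finset.insert_subset hqL hKL) hcard
    refine ⟨fun i => Nat.casesOn i K C, rfl, hCn, ?_, ?_⟩
    · rintro (_ | i) hi
      · exact hK
      · exact hCF i (by lia)
    · rintro (_ | i) hi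
      · exact ⟨q, hqK, hC0⟩
      · exact hCstep i (by lia)

/-- If `K ⊂ L` both belong to a family satisfying L1 and L2, with `|L \ K| = n`,
then there is a chain `K = K₀ ⊂ K₁ ⊂ ⋯ ⊂ Kₙ = L` in the family, each step
adding a single element. -/
theorem chain_of_subset {U : Type*} [DecidableEq U] (F : Set (Finset U))
    (hL1 : AxiomL1 F) (hL2 : AxiomL2 F) (K L : Finset U)
    (hK : K ∈ F) (hL : L ∈ F) (hKL : K ⊂ L) (n : ℕ) (hn : (L \ K).card = n) :
    ∃ C : ℕ → Finset U, C 0 = K ∧ C n = L ∧ (∀ i ≤ n, C i ∈ F) ∧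
      (∀ i < n, C i ⊂ C (i + 1)) ∧
      (∀ i < n, ∃ q, q ∉ C i ∧ C (i + 1) = insert q (C i)) := by
  obtain ⟨C, hC0, hCn, hCF, hCstep⟩ := hL2.exists_chain hL1 hL n K hK hKL.subset hn
  refine ⟨C, hC0, hCn, hCF, fun i hi => ?_, hCstep⟩
  obtain ⟨q, hq, hstep⟩ := hCstep i hi
  exact hstep ▸ Finset.ssubset_insert hq
end

section
/- Let 𝓕 be a family of finite subsets of a set U satisfying axioms L1 and L2, and let K, L ∈ 𝓕 with K ⊂ L. If K ∪ {q} ∈ 𝓕 and q ∉ L, then L ∪ {q} ∈ 𝓕. -/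
/-- A family satisfying L1 and L2 is closed under unions. -/
theorem union_mem_of_axiomL1_of_axiomL2 {U : Type*} [DecidableEq U] {F : Set (Finset U)}
    (hL1 : AxiomL1 F) (hL2 : AxiomL2 F) (A B : Finset U) (hA : A ∈ F) (hB : B ∈ F) :
    A ∪ B ∈ F := by
  induction A using Finset.strongInduction generalizing B with
  | H A ihA =>
    induction B using Finset.strongInduction with
    | H B ihB =>
      rcases A.eq_empty_or_nonempty with rfl | hAne
      · simpa using hB
      rcases B.eq_empty_or_nonempty with rfl | hBne
      · simpa using hA
      obtain ⟨a, ha, hA'⟩ := hL1 A hA hAne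
      obtain ⟨b, hb, hB'⟩ := hL1 B hB hBne
      have hAB' := ihA _ (Finset.erase_ssubset ha) _ hA' hB'
      have h_left : insert a (A.erase a ∪ B.erase b) ∈ F := by
        rw [← Finset.insert_union, Finset.insert_erase ha]
        exact ihB _ (Finset.erase_ssubset hb) hB'
      have h_right : insert b (A.erase a ∪ B.erase b) ∈ F := by
        rw [← Finset.union_insert, Finset.insert_erase hb]
        exact ihA _ (Finset.erase_ssubset ha) _ hA' hB
      have h := hL2 _ a b hAB' h_left h_right
      rwa [← Finset.union_insert, Finset.insert_erase hb, ← Finset.insert_union,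
        Finset.insert_erase ha] at h

/-- If `K ⊂ L` both belong to a family satisfying L1 and L2, `K ∪ {q}` belongs
to the family, and `q ∉ L`, then `L ∪ {q}` belongs to the family. -/
theorem insert_mem_of_subset {U : Type*} [DecidableEq U] (F : Set (Finset U))
    (hL1 : AxiomL1 F) (hL2 : AxiomL2 F) (K L : Finset U)
    (hK : K ∈ F) (hL : L ∈ F) (hKL : K ⊂ L) (q : U)
    (hq : insert q K ∈ F) (hqL : q ∉ L) :
    insert q L ∈ F := by
  have h := union_mem_of_axiomL1_of_axiomL2 hL1 hL2 _ _ hq hL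
  rwa [Finset.insert_union, Finset.union_eq_right.mpr hKL.subset] at h
end

section
/- Let 𝓕 be a finite nonempty family of finite subsets of a set U satisfying axioms L1 and L2. Then the union ⋃𝓕 of all members of 𝓕 belongs to 𝓕. -/
/-- A family of finite sets satisfying axioms L1 and L2 is closed under binary unions. -/
theorem AxiomL2.supClosed {U : Type*} [DecidableEq U] {F : Set (Finset U)}
    (hL2 : AxiomL2 F) (hL1 : AxiomL1 F) : SupClosed F := by
  intro S hS T hT
  induction hn : S.card + T.card using Nat.strong_induction_on generalizing S T with
  | _ n ih =>
    subst hn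
    rcases S.eq_empty_or_nonempty with rfl | hSne
    · simpa using hT
    rcases T.eq_empty_or_nonempty with rfl | hTne
    · simpa using hS
    obtain ⟨x, hx, hSx⟩ := hL1 S hS hSne
    obtain ⟨y, hy, hTy⟩ := hL1 T hT hTne
    have hxc := Finset.card_erase_lt_of_mem hx
    have hyc := Finset.card_erase_lt_of_mem hy
    have hxy := ih _ (by lia) hSx hTy rfl
    have hx' : insert x (S.erase x ⊔ T.erase y) ∈ F := by
      rw [Finset.sup_eq_union, ← Finset.insert_union, Finset.insert_erase hx]
      exact ih _ (by lia) hS hTy rfl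
    have hy' : insert y (S.erase x ⊔ T.erase y) ∈ F := by
      rw [Finset.sup_eq_union, ← Finset.union_insert, Finset.insert_erase hy]
      exact ih _ (by lia) hSx hT rfl
    have h := hL2 _ x y hxy hx' hy'
    rwa [Finset.sup_eq_union, ← Finset.union_insert, Finset.insert_erase hy,
      ← Finset.insert_union, Finset.insert_erase hx] at h

/-- For a finite nonempty family of finite sets satisfying axioms L1 and L2, the
union of all members of the family belongs to the family. -/
theorem union_all_mem {U : Type*} [DecidableEq U] (F : Set (Finset U))
    (hfin : F.Finite) (hne : F.Nonempty)
    (hL1 : AxiomL1 F) (hL2 : AxiomL2 F) :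
    hfin.toFinset.sup id ∈ F :=
  (hL2.supClosed hL1).finsetSup_mem (hfin.toFinset_nonempty.2 hne)
    fun _ hS => hfin.mem_toFinset.1 hS
end

section
/- Let n ∈ ℕ and let a, b : Fin n → ℝ be injective functions; for i ∈ Fin n let Q i = {p ∈ ℝ² | p₁ ≤ a i ∧ p₂ ≤ b i}, and for p ∈ ℝ² let S(p) = {i ∈ Fin n | p ∉ Q i}. Then the family 𝓕 = {S(p) | p ∈ ℝ²} satisfies axiom L1: for every nonempty S ∈ 𝓕 there exists i ∈ S with S \ {i} ∈ 𝓕. -/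
/-- The set of quadrants `Q i = {p | p₁ ≤ a i ∧ p₂ ≤ b i}` not containing a
point `p` of the plane. -/
noncomputable def regionSet {n : ℕ} (a b : Fin n → ℝ) (p : ℝ × ℝ) : Finset (Fin n) :=
  Finset.univ.filter fun i => ¬(p.1 ≤ a i ∧ p.2 ≤ b i)

theorem mem_regionSet {n : ℕ} {a b : Fin n → ℝ} {p : ℝ × ℝ} {i : Fin n} :
    i ∈ regionSet a b p ↔ a i < p.1 ∨ b i < p.2 := by
  simp [regionSet, imp_iff_not_or]

/-- Moving `p` left to the largest `a i` below `p.1` among the quadrants with `p.2 ≤ b i` removes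
exactly `i` from the region set. -/
theorem regionSet_erase_of_left_max {n : ℕ} {a b : Fin n → ℝ} (ha : Function.Injective a)
    {p : ℝ × ℝ} {i : Fin n} (hai : a i < p.1) (hbi : p.2 ≤ b i)
    (hmax : ∀ j, a j < p.1 → p.2 ≤ b j → a j ≤ a i) :
    (regionSet a b p).erase i = regionSet a b (a i, p.2) := by
  ext j
  simp only [Finset.mem_erase, mem_regionSet]
  constructor
  · rintro ⟨hne, hj⟩
    by_contra! h
    exact hne (ha (le_antisymm (hmax j (hj.resolve_right h.2.not_gt) h.2) h.1))
  · rintro (h | h)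
    · exact ⟨fun hji => h.ne (congrArg a hji), Or.inl (h.trans hai)⟩
    · exact ⟨fun hji => (hji ▸ h).not_ge hbi, Or.inr h⟩

/-- If every quadrant of the region set of `p` lies below `p`, then moving `p` down to the highest
of them, and far enough to the left, removes exactly that quadrant. -/
theorem regionSet_erase_of_below_max {n : ℕ} {a b : Fin n → ℝ} (hb : Function.Injective b)
    {p : ℝ × ℝ} {i : Fin n} {q : ℝ} (hq : ∀ j, q ≤ a j)
    (hbelow : ∀ j, a j < p.1 → b j < p.2) (hbi : b i < p.2)
    (hmax : ∀ j, b j < p.2 → b j ≤ b i) :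
    (regionSet a b p).erase i = regionSet a b (q, b i) := by
  ext j
  simp only [Finset.mem_erase, mem_regionSet]
  constructor
  · rintro ⟨hne, hj⟩
    exact Or.inr ((hmax j (hj.elim (hbelow j) id)).lt_of_ne (hb.ne hne))
  · rintro (h | h)
    · exact absurd h (hq j).not_gt
    · exact ⟨fun hji => h.ne (congrArg b hji), Or.inr (h.trans hbi)⟩

/-- The family of region sets of an arrangement of quadrants satisfies axiom L1. -/
theorem arrangement_axiomL1 (n : ℕ) (a b : Fin n → ℝ)
    (ha : Function.Injective a) (hb : Function.Injective b) :
    AxiomL1 {S : Finset (Fin n) | ∃ p : ℝ × ℝ, S = regionSet a b p} := by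
  rintro S ⟨p, rfl⟩ ⟨k, hk⟩
  by_cases h : ∃ j, a j < p.1 ∧ p.2 ≤ b j
  · obtain ⟨i, ⟨hai, hbi⟩, hmax⟩ :=
      Set.exists_max_image {j | a j < p.1 ∧ p.2 ≤ b j} a (Set.toFinite _) h
    exact ⟨i, mem_regionSet.2 (Or.inl hai), _,
      regionSet_erase_of_left_max ha hai hbi fun j hj hj' => hmax j ⟨hj, hj'⟩⟩
  · push Not at h
    obtain ⟨q, hq⟩ := (Set.finite_range a).bddBelow
    obtain ⟨i, hbi, hmax⟩ := Set.exists_max_image {j | b j < p.2} b (Set.toFinite _)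
      ⟨k, (mem_regionSet.1 hk).elim (h k) id⟩
    exact ⟨i, mem_regionSet.2 (Or.inr hbi), _,
      regionSet_erase_of_below_max hb (fun j => hq ⟨j, rfl⟩) h hbi hmax⟩
end

section
/- Let n ∈ ℕ and let a, b : Fin n → ℝ be injective functions; for i ∈ Fin n let Q i = {p ∈ ℝ² | p₁ ≤ a i ∧ p₂ ≤ b i}, and for p ∈ ℝ² let S(p) = {i ∈ Fin n | p ∉ Q i}. Then the family 𝓕 = {S(p) | p ∈ ℝ²} satisfies axiom L2: whenever S, S ∪ {x}, and S ∪ {y} all belong to 𝓕, then S ∪ {x, y} ∈ 𝓕. -/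
/-- The union of two region sets is the region set of the coordinatewise maximum. -/
theorem regionSet_union_regionSet {n : ℕ} (a b : Fin n → ℝ) (p q : ℝ × ℝ) :
    regionSet a b p ∪ regionSet a b q = regionSet a b (p ⊔ q) := by
  ext i
  simp only [regionSet, Finset.mem_union, Finset.mem_filter, Finset.mem_univ, true_and,
    Prod.fst_sup, Prod.snd_sup, sup_le_iff]
  tauto

/-- The family of region sets of an arrangement of quadrants satisfies axiom L2. -/
theorem arrangement_axiomL2 (n : ℕ) (a b : Fin n → ℝ)
    (ha : Function.Injective a) (hb : Function.Injective b) :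
    AxiomL2 {S : Finset (Fin n) | ∃ p : ℝ × ℝ, S = regionSet a b p} := by
  rintro S x y - ⟨p, hp⟩ ⟨q, hq⟩
  refine ⟨p ⊔ q, ?_⟩
  rw [← regionSet_union_regionSet, ← hp, ← hq, Finset.insert_union, Finset.union_insert,
    Finset.union_self]
end

section
/- Let n ∈ ℕ and let a, b : Fin n → ℝ be injective functions; for i ∈ Fin n let Q i = {p ∈ ℝ² | p₁ ≤ a i ∧ p₂ ≤ b i}, and for p ∈ ℝ² let S(p) = {i ∈ Fin n | p ∉ Q i}. Then the family 𝓕 = {S(p) | p ∈ ℝ²} has at most 1 + n(n+1)/2 members; that is, the arrangement of n quadrants has at most 1 + n(n+1)/2 regions. -/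
/-- A region is either the one outside all quadrants, or it is the region of the coordinatewise
minimum of the translation vectors of two (possibly equal) quadrants. -/
lemma regionSet_eq_univ_or_exists_inf {n : ℕ} (a b : Fin n → ℝ) (p : ℝ × ℝ) :
    regionSet a b p = Finset.univ ∨
      ∃ z : Sym2 (Fin n), regionSet a b ((z.map a).inf, (z.map b).inf) = regionSet a b p := by
  set T : Finset (Fin n) := Finset.univ.filter fun i => p.1 ≤ a i ∧ p.2 ≤ b i with hT
  rcases T.eq_empty_or_nonempty with h | h
  · left
    ext k
    have hk : k ∉ T := by simp [h]
    simpa [hT, regionSet] using hk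
  · right
    obtain ⟨i, hi, hia⟩ := T.exists_min_image a h
    obtain ⟨j, hj, hjb⟩ := T.exists_min_image b h
    have haij := hia j hj
    have hbij := hjb i hi
    refine ⟨s(i, j), ?_⟩
    simp only [hT, Finset.mem_filter, Finset.mem_univ, true_and] at hi hj hia hjb
    ext k
    simp only [regionSet, Sym2.map_mk, Sym2.inf_mk, inf_eq_left.mpr haij, inf_eq_right.mpr hbij,
      Finset.mem_filter, Finset.mem_univ, true_and, not_iff_not]
    exact ⟨fun hk => ⟨hi.1.trans hk.1, hj.2.trans hk.2⟩, fun hk => ⟨hia k hk, hjb k hk⟩⟩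

/-- An arrangement of `n` quadrants has at most `1 + n (n + 1) / 2` regions. -/
theorem arrangement_card_regions (n : ℕ) (a b : Fin n → ℝ)
    (ha : Function.Injective a) (hb : Function.Injective b) :
    Set.ncard {S : Finset (Fin n) | ∃ p : ℝ × ℝ, S = regionSet a b p} ≤
      1 + n * (n + 1) / 2 := by
  let f : Sym2 (Fin n) → Finset (Fin n) := fun z => regionSet a b ((z.map a).inf, (z.map b).inf)
  have hsub : {S : Finset (Fin n) | ∃ p : ℝ × ℝ, S = regionSet a b p} ⊆
      insert Finset.univ (Set.range f) := by
    rintro S ⟨p, rfl⟩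
    exact regionSet_eq_univ_or_exists_inf a b p
  have hrange : (Set.range f).ncard ≤ n * (n + 1) / 2 := by
    calc (Set.range f).ncard ≤ Nat.card (Sym2 (Fin n)) := by
          rw [← Set.image_univ, ← Set.ncard_univ]
          exact Set.ncard_image_le
      _ = n * (n + 1) / 2 := by
          rw [Nat.card_eq_fintype_card, Sym2.card, Fintype.card_fin, Nat.choose_two_right,
            Nat.add_sub_cancel, mul_comm]
  calc _ ≤ (insert Finset.univ (Set.range f)).ncard := Set.ncard_le_ncard hsub
    _ ≤ (Set.range f).ncard + 1 := Set.ncard_insert_le _ _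
    _ ≤ 1 + n * (n + 1) / 2 := by omega
end

section
/- Let n ∈ ℕ and let a, b, a', b' : Fin n → ℝ be injective functions such that for all i, j ∈ Fin n, a i < a j ↔ a' i < a' j and b i < b j ↔ b' i < b' j. For p ∈ ℝ² define S(p) = {i ∈ Fin n | ¬(p₁ ≤ a i ∧ p₂ ≤ b i)} and S'(p) = {i ∈ Fin n | ¬(p₁ ≤ a' i ∧ p₂ ≤ b' i)}. Then {S(p) | p ∈ ℝ²} = {S'(p) | p ∈ ℝ²}: the family of region sets of an arrangement of quadrants depends only on the relative orders of the x-coordinates and of the y-coordinates of the translation vectors. (Consequently there are at most n! combinatorially distinct such families over n quadrants.) -/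
/-- Thresholds transfer between two finite real families with the same strict order: every
upper set cut out of one by a threshold is cut out of the other by some threshold. -/
theorem exists_threshold_iff {ι : Type*} [Finite ι] {f g : ι → ℝ}
    (h : ∀ i j, f i < f j ↔ g i < g j) (x : ℝ) : ∃ y : ℝ, ∀ i, x ≤ f i ↔ y ≤ g i := by
  rcases Set.eq_empty_or_nonempty {i | x ≤ f i} with hT | hT
  · obtain ⟨M, hM⟩ := (Set.finite_range g).bddAbove
    refine ⟨M + 1, fun i => iff_of_false (fun hi => ?_) ?_⟩
    · exact Set.eq_empty_iff_forall_notMem.1 hT i hi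
    · linarith [hM (Set.mem_range_self i)]
  · obtain ⟨m, hm, hmin⟩ := Set.exists_min_image _ g (Set.toFinite _) hT
    refine ⟨g m, fun i => ⟨hmin i, fun hi => le_trans hm ?_⟩⟩
    exact not_lt.1 fun hlt => not_lt.2 hi ((h i m).1 hlt)

/-- Every region set of an arrangement is a region set of any arrangement with the same
coordinate orders. -/
theorem exists_regionSet_eq {n : ℕ} {a b a' b' : Fin n → ℝ}
    (horda : ∀ i j, a i < a j ↔ a' i < a' j) (hordb : ∀ i j, b i < b j ↔ b' i < b' j)
    (p : ℝ × ℝ) : ∃ q : ℝ × ℝ, regionSet a b p = regionSet a' b' q := by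
  obtain ⟨x, hx⟩ := exists_threshold_iff horda p.1
  obtain ⟨y, hy⟩ := exists_threshold_iff hordb p.2
  exact ⟨(x, y), by simp only [regionSet, hx, hy]⟩

/-- The family of region sets of an arrangement of quadrants depends only on the
relative orders of the `x`-coordinates and of the `y`-coordinates of the
translation vectors: two arrangements whose coordinate orders agree have the
same families of region sets.  (Consequently there are at most `n!`
combinatorially distinct such families over `n` quadrants.) -/
theorem arrangement_order_invariant (n : ℕ) (a b a' b' : Fin n → ℝ)
    (ha : Function.Injective a) (hb : Function.Injective b)
    (ha' : Function.Injective a') (hb' : Function.Injective b')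
    (horda : ∀ i j : Fin n, a i < a j ↔ a' i < a' j)
    (hordb : ∀ i j : Fin n, b i < b j ↔ b' i < b' j) :
    {S : Finset (Fin n) | ∃ p : ℝ × ℝ, S = regionSet a b p} =
      {S : Finset (Fin n) | ∃ p : ℝ × ℝ, S = regionSet a' b' p} := by
  ext S
  constructor
  · rintro ⟨p, rfl⟩
    exact exists_regionSet_eq horda hordb p
  · rintro ⟨p, rfl⟩
    exact exists_regionSet_eq (fun i j => (horda i j).symm) (fun i j => (hordb i j).symm) p
end

section
/- Fix n ∈ ℕ and let 𝓕 be the family of all subsets of Fin n that are the union of a prefix and a suffix, i.e., 𝓕 = {S ⊆ Fin n | ∃ c d : ℕ, S = {i | (i:ℕ) < c} ∪ {i | d ≤ (i:ℕ)}}. Then 𝓕 has exactly 1 + n(n+1)/2 members. (This shows that the bound of 1 + (|U|+1)|U|/2 states for an st-planar learning space over a set U is tight.) -/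
/-- The family of subsets of `Fin n` that are the union of a prefix
`{i | i < c}` and a suffix `{i | d ≤ i}`. -/
def prefixSuffix (n : ℕ) : Set (Finset (Fin n)) :=
  {S | ∃ c d : ℕ, S = Finset.univ.filter fun i : Fin n => (i : ℕ) < c ∨ d ≤ (i : ℕ)}

/-- The pairs `⟨b, a⟩` with `a ≤ b < n`, which index the nonempty intervals `[a, b]` of `Fin n`. -/
def intervalPairs (n : ℕ) : Finset (Σ _ : ℕ, ℕ) :=
  (Finset.range n).sigma fun b => Finset.range (b + 1)

/-- The complement in `Fin n` of the interval `[a, b]`, for `p = ⟨b, a⟩`. -/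
def intervalCompl (n : ℕ) (p : Σ _ : ℕ, ℕ) : Finset (Fin n) :=
  Finset.univ.filter fun i : Fin n => (i : ℕ) < p.2 ∨ p.1 + 1 ≤ (i : ℕ)

theorem mem_intervalPairs {n : ℕ} {p : Σ _ : ℕ, ℕ} :
    p ∈ intervalPairs n ↔ p.1 < n ∧ p.2 ≤ p.1 := by
  simp [intervalPairs]

theorem card_intervalPairs (n : ℕ) : (intervalPairs n).card = n * (n + 1) / 2 := by
  have h := Finset.sum_range_id (n + 1)
  rw [Finset.sum_range_succ'] at h
  simpa [intervalPairs, Finset.card_sigma, mul_comm] using h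

theorem mem_intervalCompl {n : ℕ} {p : Σ _ : ℕ, ℕ} {i : Fin n} :
    i ∈ intervalCompl n p ↔ (i : ℕ) < p.2 ∨ p.1 < (i : ℕ) := by
  simp [intervalCompl]

theorem intervalCompl_injOn (n : ℕ) :
    Set.InjOn (intervalCompl n) (intervalPairs n : Set (Σ _ : ℕ, ℕ)) := by
  rintro ⟨b, a⟩ hp ⟨b', a'⟩ hq h
  have hp := mem_intervalPairs.1 (Finset.mem_coe.1 hp)
  have hq := mem_intervalPairs.1 (Finset.mem_coe.1 hq)
  dsimp only at hp hq
  have key (i : ℕ) (hi : i < n) : (i < a ∨ b < i) ↔ (i < a' ∨ b' < i) := by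
    have := Finset.ext_iff.1 h ⟨i, hi⟩
    rwa [mem_intervalCompl, mem_intervalCompl] at this
  have ha := key a (by omega)
  have hb := key b (by omega)
  have ha' := key a' (by omega)
  have hb' := key b' (by omega)
  obtain rfl : a = a' := by omega
  obtain rfl : b = b' := by omega
  rfl

theorem univ_notMem_image_intervalCompl (n : ℕ) :
    Finset.univ ∉ (intervalPairs n).image (intervalCompl n) := by
  intro h
  obtain ⟨p, hp, h⟩ := Finset.mem_image.1 h
  obtain ⟨hb, ha⟩ := mem_intervalPairs.1 hp
  have := mem_intervalCompl.1 (h ▸ Finset.mem_univ (⟨p.1, hb⟩ : Fin n))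
  dsimp only at this
  omega

theorem prefixSuffix_eq_insert_image (n : ℕ) :
    prefixSuffix n =
      ((insert Finset.univ ((intervalPairs n).image (intervalCompl n)) :
        Finset (Finset (Fin n))) : Set (Finset (Fin n))) := by
  ext S
  rw [Finset.mem_coe, Finset.mem_insert, Finset.mem_image]
  constructor
  · rintro ⟨c, d, rfl⟩
    by_cases hcd : c < min d n
    · refine Or.inr ⟨⟨min d n - 1, c⟩, mem_intervalPairs.2 ⟨?_, ?_⟩, ?_⟩
      · dsimp only; omega
      · dsimp only; omega
      · ext i
        have := i.isLt
        simp only [mem_intervalCompl, Finset.mem_filter, Finset.mem_univ, true_and]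
        omega
    · left
      ext i
      have := i.isLt
      simp only [Finset.mem_filter, Finset.mem_univ, true_and, iff_true]
      omega
  · rintro (rfl | ⟨p, -, rfl⟩)
    · exact ⟨0, 0, by simp⟩
    · exact ⟨p.2, p.1 + 1, rfl⟩

/-- The family of all unions of a prefix and a suffix of `Fin n` has exactly
`1 + n (n + 1) / 2` members; hence the bound of `1 + (|U| + 1)|U| / 2` states
for an `st`-planar learning space over `U` is tight. -/
theorem prefixSuffix_card (n : ℕ) :
    Set.ncard (prefixSuffix n) = 1 + n * (n + 1) / 2 := by
  rw [prefixSuffix_eq_insert_image, Set.ncard_coe_finset,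
    Finset.card_insert_of_notMem (univ_notMem_image_intervalCompl n),
    Finset.card_image_of_injOn (intervalCompl_injOn n), card_intervalPairs, add_comm]
end

section
/- Let P be a finite set of points in ℝ^d, and let 𝓕 = {P ∩ Cᶜ | C ⊆ ℝ^d convex} be the family of intersections of P with complements of convex sets. Then 𝓕 satisfies axioms L1 and L2 (i.e., 𝓕 is an antimatroid). -/
/-- The family of intersections of a finite point set `P ⊆ ℝ^d` with complements
of convex bodies. -/
def convexComplements (d : ℕ) (P : Finset (Fin d → ℝ)) : Set (Finset (Fin d → ℝ)) :=
  {S | ∃ C : Set (Fin d → ℝ), Convex ℝ C ∧ (S : Set (Fin d → ℝ)) = ↑P ∩ Cᶜ}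

/-- The anti-exchange property of the convex hull relative to a convex set. -/
theorem Convex.eq_of_mem_convexHull_insert {𝕜 E : Type*} [Field 𝕜] [LinearOrder 𝕜]
    [IsStrictOrderedRing 𝕜] [AddCommGroup E] [Module 𝕜 E] {C : Set E} (hC : Convex 𝕜 C)
    {x y : E} (hy : y ∉ C) (hyx : y ∈ convexHull 𝕜 (insert x C))
    (hxy : x ∈ convexHull 𝕜 (insert y C)) : x = y := by
  rcases C.eq_empty_or_nonempty with rfl | hne
  · simpa using hxy
  rw [convexHull_insert hne, hC.convexHull_eq, convexJoin_singleton_left] at hyx hxy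
  simp only [Set.mem_iUnion] at hyx hxy
  obtain ⟨c, hc, a, b, ha, hb, hab, rfl⟩ := hyx
  obtain ⟨c', hc', a', b', ha', hb', hab', hx⟩ := hxy
  set y := a • x + b • c with hy_def
  have hsum : y = (a * a') • y + ((a * b') • c' + b • c) := by
    conv_lhs => rw [hy_def, ← hx]
    module
  have ha1 : a ≤ 1 := by linarith
  have ha1' : a' ≤ 1 := by linarith
  rcases (mul_le_one₀ ha1 ha' ha1').lt_or_eq with hlt | heq
  · have hpos : 0 < 1 - a * a' := by linarith
    refine absurd ?_ hy
    have hcomb : y = ((a * b') / (1 - a * a')) • c' + (b / (1 - a * a')) • c := by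
      have hscaled : (1 - a * a') • y = (a * b') • c' + b • c := by
        rw [sub_smul, one_smul, sub_eq_iff_eq_add']
        exact hsum
      rw [← inv_smul_smul₀ hpos.ne' y, hscaled, smul_add, smul_smul, smul_smul,
        div_eq_inv_mul, div_eq_inv_mul]
    rw [hcomb]
    refine hC hc' hc (by positivity) (by positivity) ?_
    rw [← add_div, div_eq_one_iff_eq hpos.ne']
    linear_combination hab + a * hab'
  · have ha'_one : a' = 1 := by nlinarith
    have hb'_zero : b' = 0 := by linarith
    rw [← hx, ha'_one, hb'_zero, one_smul, zero_smul, add_zero]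

/-- Among finitely many points outside a convex set, some point can be adjoined to the set
without its convex hull capturing any of the others. -/
theorem Convex.exists_mem_forall_mem_convexHull_insert {𝕜 E : Type*} [Field 𝕜] [LinearOrder 𝕜]
    [IsStrictOrderedRing 𝕜] [AddCommGroup E] [Module 𝕜 E] {C : Set E} (hC : Convex 𝕜 C)
    {S : Finset E} (hS : S.Nonempty) (hSC : ∀ y ∈ S, y ∉ C) :
    ∃ x ∈ S, ∀ y ∈ S, y ∈ convexHull 𝕜 (insert x C) → y = x := by
  classical
  obtain ⟨x, hxS, hmin⟩ := S.exists_min_image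
    (fun x => (S.filter (· ∈ convexHull 𝕜 (insert x C))).card) hS
  refine ⟨x, hxS, fun y hyS hyx => ?_⟩
  have hsub : convexHull 𝕜 (insert y C) ⊆ convexHull 𝕜 (insert x C) :=
    convexHull_min (Set.insert_subset hyx
      ((Set.subset_insert x C).trans (subset_convexHull 𝕜 _))) (convex_convexHull 𝕜 _)
  have heq := Finset.eq_of_subset_of_card_le
    (Finset.monotone_filter_right S fun z _ hz => hsub hz) (hmin y hyS)
  have hx : x ∈ S.filter (· ∈ convexHull 𝕜 (insert x C)) :=
    Finset.mem_filter.2 ⟨hxS, subset_convexHull 𝕜 _ (Set.mem_insert x C)⟩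
  rw [← heq, Finset.mem_filter] at hx
  exact (hC.eq_of_mem_convexHull_insert (hSC y hyS) hyx hx.2).symm

open scoped Classical in
/-- For a finite set `P` of points in `ℝ^d`, the family of intersections of `P`
with complements of convex sets satisfies axioms L1 and L2, i.e., it is an
antimatroid. -/
theorem convexComplements_antimatroid (d : ℕ) (P : Finset (Fin d → ℝ)) :
    AxiomL1 (convexComplements d P) ∧ AxiomL2 (convexComplements d P) := by
  constructor
  · rintro S ⟨C, hC, hS⟩ hne
    have hmem : ∀ z, z ∈ S ↔ z ∈ P ∧ z ∉ C := fun z => by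
      simpa using Set.ext_iff.1 hS z
    obtain ⟨x, hxS, hx⟩ := hC.exists_mem_forall_mem_convexHull_insert hne
      fun y hy => ((hmem y).1 hy).2
    refine ⟨x, hxS, convexHull ℝ (insert x C), convex_convexHull ℝ _, ?_⟩
    have hsub : insert x C ⊆ convexHull ℝ (insert x C) := subset_convexHull ℝ _
    ext z
    simp only [Finset.mem_coe, Finset.mem_erase, Set.mem_inter_iff, Set.mem_compl_iff]
    constructor
    · rintro ⟨hzx, hz⟩
      exact ⟨((hmem z).1 hz).1, fun h => hzx (hx z hz h)⟩
    · rintro ⟨hzP, hz⟩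
      refine ⟨?_, (hmem z).2 ⟨hzP, fun h => hz (hsub (Or.inr h))⟩⟩
      rintro rfl
      exact hz (hsub (Or.inl rfl))
  · rintro S x y - ⟨C, hC, hx⟩ ⟨D, hD, hy⟩
    refine ⟨C ∩ D, hC.inter hD, ?_⟩
    rw [Set.compl_inter, Set.inter_union_distrib_left, ← hx, ← hy]
    ext z
    simp only [Finset.coe_insert, Set.mem_insert_iff, Set.mem_union]
    tauto
end
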